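/- arXiv:1805.12335 — 2 statements merged into one kernel-verified Lean document; each statement's English description precedes it below -/
import Mathlib

section
/- Let H ⊂ K be a strongly discrete subgroup. Then the product defining e_H(z) converges in K for every z ∈ K; the resulting function e_H : K → K is a surjective homomorphism of additive groups whose kernel is exactly H (so e_H induces an isomorphism of additive groups K/H ≅ K). Moreover, if q is a power of p with 𝔽_q ⊂ K and H is an 𝔽_q-subspace of K, then e_H is 𝔽_q-linear, i.e. e_H(αz) = α·e_H(z) for all α ∈ 𝔽_q and z ∈ K. -/
noncomputable section

namespace Paper

/-- A subgroup `H` of `(K,+)` is strongly discrete if its intersection with every ball of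
finite radius is finite. -/
def StronglyDiscrete {K : Type*} [NormedField K] (H : AddSubgroup K) : Prop :=
  ∀ ρ : ℝ, 0 < ρ → {z : K | z ∈ H ∧ ‖z‖ ≤ ρ}.Finite

/-- The exponential function `e_H(z) = z·∏_{h ∈ H∖{0}} (1 − z/h)` associated to a strongly
discrete subgroup `H ⊂ K`. -/
noncomputable def eH {K : Type*} [NormedField K] (H : AddSubgroup K) (z : K) : K :=
  z * ∏' h : {x : K // x ∈ H ∧ x ≠ 0}, (1 - z / h.1)

lemma aux_one_le {ι : Type*} {s : Finset ι} {f : ι → ℝ} (h : ∀ i ∈ s, 1 ≤ f i) :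
    1 ≤ ∏ i ∈ s, f i := by
  have := Finset.prod_le_prod (s := s) (f := fun _ => (1:ℝ)) (g := f)
    (fun _ _ => zero_le_one) h
  simpa using this

open Polynomial Filter Topology in
lemma aux_mult {K : Type*} [NormedField K] [CompleteSpace K] [IsUltrametricDist K]
    {ι : Type*} (f : ι → K) (hf : ∀ ε : ℝ, 0 < ε → {i | ε ≤ ‖f i‖}.Finite) :
    Multipliable (fun i => 1 + f i) := by
  classical
  apply multipliable_one_add_of_summable_prod
  apply NonarchimedeanAddGroup.summable_of_tendsto_cofinite_zero
  rw [NormedAddGroup.tendsto_nhds_zero]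
  intro ε hε
  set F := (hf 1 one_pos).toFinset with hF
  set M := ∏ i ∈ F, max 1 ‖f i‖ with hM
  have hM1 : 1 ≤ M := aux_one_le (fun i _ => le_max_left _ _)
  have hM0 : 0 < M := by linarith
  set G := (hf (ε / M) (by positivity)).toFinset with hG
  have key : ∀ s : Finset ι, ∏ i ∈ s, ‖f i‖ ≤ M := by
    intro s
    calc ∏ i ∈ s, ‖f i‖ ≤ ∏ i ∈ s, (if i ∈ F then max 1 ‖f i‖ else 1) := by
          apply Finset.prod_le_prod
          · intros; positivity
          · intro i _
            split_ifs with h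
            · exact le_max_right _ _
            · simp [hF] at h; exact h.le
      _ = ∏ i ∈ s ∩ F, max 1 ‖f i‖ := by
          rw [Finset.prod_ite_mem]
      _ ≤ M := by
          rw [hM, ← Finset.prod_sdiff (Finset.inter_subset_right : s ∩ F ⊆ F)]
          apply le_mul_of_one_le_left
          · exact Finset.prod_nonneg (fun i _ => by positivity)
          · exact aux_one_le (fun i _ => le_max_left _ _)
  rw [Filter.eventually_cofinite]
  apply (G.powerset.finite_toSet).subset
  intro s hs
  simp only [Set.mem_ofPred_eq, not_lt] at hs
  simp only [Finset.coe_powerset, Set.mem_preimage, Set.mem_powerset_iff, Finset.coe_subset]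
  intro i hi
  by_contra hiG
  simp only [hG, Set.Finite.mem_toFinset, Set.mem_ofPred_eq, not_le] at hiG
  rw [norm_prod, ← Finset.mul_prod_erase _ _ hi] at hs
  have h1 := key (s.erase i)
  have : ‖f i‖ * ∏ x ∈ s.erase i, ‖f x‖ < ε := by
    calc _ ≤ ‖f i‖ * M := by gcongr
      _ < ε / M * M := by gcongr
      _ = ε := by field_simp
  linarith

lemma aux_prod_sub_one {K : Type*} [NormedField K] [IsUltrametricDist K]
    {ι : Type*} (f : ι → K) (t : ℝ) (ht0 : 0 ≤ t) (ht : t ≤ 1) (s : Finset ι)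
    (hf : ∀ i ∈ s, ‖f i‖ ≤ t) : ‖∏ i ∈ s, (1 + f i) - 1‖ ≤ t := by
  classical
  induction s using Finset.induction_on with
  | empty => simpa using ht0
  | insert a s ha ih =>
    rw [Finset.prod_insert ha]
    have h1 := ih (fun i hi => hf i (Finset.mem_insert_of_mem hi))
    have h2 := hf a (Finset.mem_insert_self _ _)
    have e : (1 + f a) * ∏ i ∈ s, (1 + f i) - 1 =
        (∏ i ∈ s, (1 + f i) - 1) + (f a + f a * (∏ i ∈ s, (1 + f i) - 1)) := by ring
    rw [e]
    refine (IsUltrametricDist.norm_add_le_max _ _).trans (max_le h1 ?_)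
    refine (IsUltrametricDist.norm_add_le_max _ _).trans (max_le h2 ?_)
    rw [norm_mul]
    nlinarith [norm_nonneg (f a), norm_nonneg (∏ i ∈ s, (1 + f i) - 1)]

open Filter Topology in
lemma aux_tprod {K : Type*} [NormedField K] [IsUltrametricDist K]
    {ι : Type*} (f : ι → K) (hm : Multipliable (fun i => 1 + f i))
    (t : ℝ) (ht0 : 0 ≤ t) (ht : t ≤ 1) (F : Finset ι)
    (hf : ∀ i, i ∉ F → ‖f i‖ ≤ t) :
    ‖∏' i, (1 + f i) - ∏ i ∈ F, (1 + f i)‖ ≤ ‖∏ i ∈ F, (1 + f i)‖ * t := by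
  classical
  have h : Tendsto (fun s : Finset ι => ‖∏ i ∈ s, (1 + f i) - ∏ i ∈ F, (1 + f i)‖) atTop
      (𝓝 ‖∏' i, (1 + f i) - ∏ i ∈ F, (1 + f i)‖) :=
    (Tendsto.sub_const hm.hasProd _).norm
  refine le_of_tendsto h ?_
  filter_upwards [eventually_ge_atTop F] with s hs
  have h2 := aux_prod_sub_one f t ht0 ht (s \ F) (fun i hi => hf i (Finset.mem_sdiff.1 hi).2)
  rw [← Finset.prod_sdiff hs]
  have e : (∏ i ∈ s \ F, (1 + f i)) * ∏ i ∈ F, (1 + f i) - ∏ i ∈ F, (1 + f i)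
    = (∏ i ∈ F, (1 + f i)) * (∏ i ∈ s \ F, (1 + f i) - 1) := by ring
  rw [e, norm_mul]
  gcongr

/-- finite exponential -/
def EF {K : Type*} [Field K] [DecidableEq K] (T : Finset K) (z : K) : K :=
  z * ∏ x ∈ T.erase 0, (1 - z / x)

lemma EF_eq {K : Type*} [Field K] [DecidableEq K] (T : Finset K) (h0 : (0:K) ∈ T) (z : K) :
    EF T z * ∏ x ∈ T.erase 0, (-x) = ∏ x ∈ T, (z - x) := by
  rw [EF, mul_assoc, ← Finset.prod_mul_distrib, ← Finset.mul_prod_erase _ _ h0, sub_zero]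
  congr 1
  apply Finset.prod_congr rfl
  intro x hx
  have : x ≠ 0 := (Finset.mem_erase.1 hx).1
  field_simp
  ring

lemma EF_ne {K : Type*} [Field K] [DecidableEq K] (T : Finset K) :
    ∏ x ∈ T.erase 0, (-x) ≠ 0 := by
  rw [Finset.prod_ne_zero_iff]
  intro x hx
  exact neg_ne_zero.2 (Finset.mem_erase.1 hx).1

open Polynomial in
lemma EF_add {K : Type*} [Field K] [DecidableEq K] (T : Finset K) (h0 : (0:K) ∈ T)
    (hs : ∀ x ∈ T, ∀ y ∈ T, x - y ∈ T) (z w : K) :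
    EF T (z + w) = EF T z + EF T w := by
  apply mul_right_cancel₀ (EF_ne T)
  rw [add_mul, EF_eq T h0, EF_eq T h0, EF_eq T h0]
  set P : K[X] := ∏ x ∈ T, (X - C x) with hP
  have hPm : P.Monic := monic_prod_of_monic _ _ (fun x _ => monic_X_sub_C x)
  have hPd : P.natDegree = T.card := by simp [hP]
  have hPe : ∀ u, P.eval u = ∏ x ∈ T, (u - x) := fun u => by simp [hP, eval_prod]
  have hneg : ∀ x ∈ T, -x ∈ T := fun x hx => by simpa using hs 0 h0 x hx
  have hcpos : 0 < T.card := Finset.card_pos.2 ⟨0, h0⟩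
  have hQ : P.comp (X + C w) = P + C (P.eval w) := by
    apply eq_of_degree_sub_lt_of_eval_finset_eq T
    · have hd1 : (P.comp (X + C w)).Monic := hPm.comp_X_add_C w
      have hn1 : (P.comp (X + C w)).natDegree = T.card := by
        rw [natDegree_comp, natDegree_X_add_C, mul_one, hPd]
      have hdP : P.degree = T.card := by
        rw [degree_eq_natDegree hPm.ne_zero, hPd]
      have hd1' : (P.comp (X + C w)).degree = T.card := by
        rw [degree_eq_natDegree hd1.ne_zero, hn1]
      have hlt : (C (P.eval w)).degree < P.degree := by
        rw [hdP]
        exact lt_of_le_of_lt degree_C_le (by exact_mod_cast hcpos)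
      have := degree_sub_lt_left (p := P.comp (X + C w)) (q := P + C (P.eval w))
        (by rw [degree_add_eq_left_of_degree_lt hlt, hdP, hd1']) hd1.ne_zero
        (by rw [hd1.leadingCoeff, leadingCoeff_add_of_degree_lt' hlt, hPm.leadingCoeff])
      rwa [hd1'] at this
    · intro x hx
      have hx0 : P.eval x = 0 := by
        rw [hPe]; exact Finset.prod_eq_zero hx (sub_self x)
      simp only [eval_comp, eval_add, eval_X, eval_C, hx0, zero_add]
      rw [hPe, hPe]
      apply Finset.prod_bij' (fun y _ => y - x) (fun y _ => y + x)
      · intro y hy; exact hs y hy x hx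
      · intro y hy; simpa using hs y hy (-x) (hneg x hx)
      · intro y _; ring
      · intro y _; ring
      · intro y _; ring
  have := congrArg (eval z) hQ
  simp only [eval_comp, eval_add, eval_X, eval_C] at this
  rw [← hPe, ← hPe, ← hPe, this]

open Polynomial in
lemma EF_surj {K : Type*} [NormedField K] [IsAlgClosed K] [IsUltrametricDist K]
    [DecidableEq K] (T : Finset K) (h0 : (0:K) ∈ T)
    (hs : ∀ x ∈ T, ∀ y ∈ T, x - y ∈ T) (c : K) :
    ∃ w, EF T w = c ∧ ‖w‖ ≤ ‖c‖ := by
  have hneg : ∀ x ∈ T, -x ∈ T := fun x hx => by simpa using hs 0 h0 x hx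
  have hcpos : 0 < T.card := Finset.card_pos.2 ⟨0, h0⟩
  obtain ⟨w, hw⟩ : ∃ w, EF T w = c := by
    set P : K[X] := ∏ x ∈ T, (X - C x) with hP
    have hPd : P.natDegree = T.card := by simp [hP]
    have hPe : ∀ u, P.eval u = ∏ x ∈ T, (u - x) := fun u => by simp [hP, eval_prod]
    obtain ⟨w, hw⟩ := IsAlgClosed.exists_root (P - C (c * ∏ x ∈ T.erase 0, (-x))) (by
      intro h
      have := natDegree_eq_zero_iff_degree_le_zero.2 h.le
      rw [natDegree_sub_C, hPd] at this
      omega)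
    refine ⟨w, mul_right_cancel₀ (EF_ne T) ?_⟩
    rw [EF_eq T h0, ← hPe]
    rw [IsRoot, eval_sub, eval_C, sub_eq_zero] at hw
    exact hw
  obtain ⟨x0, hx0, hmin⟩ := T.exists_min_image (fun x => ‖w - x‖) ⟨0, h0⟩
  have hEx : EF T x0 = 0 := by
    apply mul_right_cancel₀ (EF_ne T)
    rw [EF_eq T h0, zero_mul]; exact Finset.prod_eq_zero hx0 (sub_self x0)
  have hE : EF T (w - x0) = c := by
    have := EF_add T h0 hs (w - x0) x0
    rw [sub_add_cancel, hEx, add_zero] at this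
    rw [← this, hw]
  refine ⟨w - x0, hE, ?_⟩
  set v := w - x0 with hv
  have hmin' : ∀ x ∈ T, ‖v‖ ≤ ‖v - x‖ := by
    intro x hx
    have h1 := hmin (x0 + x) (by simpa using hs x0 hx0 (-x) (hneg x hx))
    have : v - x = w - (x0 + x) := by rw [hv]; ring
    rw [this]; exact h1
  rw [← hE, EF, norm_mul, norm_prod]
  apply le_mul_of_one_le_right (norm_nonneg _)
  apply aux_one_le
  intro x hx
  obtain ⟨hx0, hxT⟩ := Finset.mem_erase.1 hx
  have e : 1 - v / x = -((v - x) / x) := by field_simp; ring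
  rw [e, norm_neg, norm_div, one_le_div (norm_pos_iff.2 hx0)]
  have h1 := hmin' x hxT
  have h2 : x = v + -(v - x) := by ring
  calc ‖x‖ = ‖v + -(v - x)‖ := by rw [← h2]
    _ ≤ max ‖v‖ ‖-(v - x)‖ := IsUltrametricDist.norm_add_le_max _ _
    _ ≤ ‖v - x‖ := by rw [norm_neg]; exact max_le h1 le_rfl

section
variable {K : Type*} [NormedField K]

/-- finite truncation of `H` -/
def TF {H : AddSubgroup K} (hH : StronglyDiscrete H) (n : ℕ) : Finset K :=
  (hH (n + 1) (by positivity)).toFinset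

lemma mem_TF {H : AddSubgroup K} (hH : StronglyDiscrete H) (n : ℕ) (x : K) :
    x ∈ TF hH n ↔ x ∈ H ∧ ‖x‖ ≤ n + 1 := by simp [TF]

lemma zero_mem_TF {H : AddSubgroup K} (hH : StronglyDiscrete H) (n : ℕ) :
    (0 : K) ∈ TF hH n := by
  rw [mem_TF]; exact ⟨H.zero_mem, by rw [norm_zero]; positivity⟩

lemma sub_mem_TF [IsUltrametricDist K] {H : AddSubgroup K} (hH : StronglyDiscrete H) (n : ℕ) :
    ∀ x ∈ TF hH n, ∀ y ∈ TF hH n, x - y ∈ TF hH n := by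
  intro x hx y hy
  rw [mem_TF] at *
  refine ⟨H.sub_mem hx.1 hy.1, ?_⟩
  rw [sub_eq_add_neg]
  refine (IsUltrametricDist.norm_add_le_max _ _).trans (max_le hx.2 ?_)
  rw [norm_neg]; exact hy.2

open Classical in
/-- subtype version -/
def SF {H : AddSubgroup K} (hH : StronglyDiscrete H) (n : ℕ) :
    Finset {x : K // x ∈ H ∧ x ≠ 0} := (TF hH n).subtype _

lemma mem_SF {H : AddSubgroup K} (hH : StronglyDiscrete H) (n : ℕ)
    (x : {x : K // x ∈ H ∧ x ≠ 0}) : x ∈ SF hH n ↔ ‖x.1‖ ≤ n + 1 := by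
  simp [SF, mem_TF, x.2.1]

open Classical in
lemma prod_SF {H : AddSubgroup K} (hH : StronglyDiscrete H) (n : ℕ) (g : K → K) :
    ∏ x ∈ SF hH n, g x.1 = ∏ x ∈ (TF hH n).erase 0, g x := by
  rw [SF, Finset.prod_subtype_eq_prod_filter]
  congr 1
  ext x
  simp only [Finset.mem_filter, Finset.mem_erase, mem_TF]
  tauto

open Classical in
lemma EF_SF {H : AddSubgroup K} (hH : StronglyDiscrete H) (n : ℕ) (z : K) :
    EF (TF hH n) z = z * ∏ x ∈ SF hH n, (1 + -(z / x.1)) := by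
  rw [EF, ← prod_SF hH n (fun x => 1 - z / x)]
  simp only [sub_eq_add_neg]

lemma eH_mult [CompleteSpace K] [IsUltrametricDist K] {H : AddSubgroup K}
    (hH : StronglyDiscrete H) (z : K) :
    Multipliable fun h : {x : K // x ∈ H ∧ x ≠ 0} => (1 + -(z / h.1)) := by
  apply aux_mult
  intro ε hε
  obtain ⟨n, hn⟩ := exists_nat_ge (‖z‖ / ε)
  apply (SF hH n).finite_toSet.subset
  intro x hx
  simp only [Set.mem_ofPred_eq, norm_neg, norm_div] at hx
  have hx0 : 0 < ‖x.1‖ := norm_pos_iff.2 x.2.2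
  simp only [Finset.mem_coe, mem_SF]
  rw [le_div_iff₀ hx0] at hx
  rw [div_le_iff₀ hε] at hn
  nlinarith

lemma eH_eq {H : AddSubgroup K} (z : K) :
    eH H z = z * ∏' h : {x : K // x ∈ H ∧ x ≠ 0}, (1 + -(z / h.1)) := by
  simp only [eH, sub_eq_add_neg]

open Classical in
lemma eH_approx [CompleteSpace K] [IsUltrametricDist K] {H : AddSubgroup K}
    (hH : StronglyDiscrete H) (z : K) (n : ℕ) (t : ℝ) (ht0 : 0 ≤ t) (ht : t ≤ 1)
    (h : ‖z‖ ≤ t * (n + 1)) :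
    ‖eH H z - EF (TF hH n) z‖ ≤ ‖EF (TF hH n) z‖ * t := by
  have := aux_tprod (fun h : {x : K // x ∈ H ∧ x ≠ 0} => -(z / h.1)) (eH_mult hH z) t ht0 ht
    (SF hH n) (by
      intro x hx
      have hx0 : 0 < ‖x.1‖ := norm_pos_iff.2 x.2.2
      rw [mem_SF, not_le] at hx
      rw [norm_neg, norm_div, div_le_iff₀ hx0]
      nlinarith)
  rw [EF_SF, eH_eq, ← mul_sub, norm_mul, norm_mul, mul_assoc]
  gcongr

open Classical Filter Topology in
lemma eH_lim [CompleteSpace K] [IsUltrametricDist K] {H : AddSubgroup K}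
    (hH : StronglyDiscrete H) (z : K) :
    Tendsto (fun n => EF (TF hH n) z) atTop (𝓝 (eH H z)) := by
  simp only [EF_SF, eH_eq]
  apply Tendsto.const_mul
  have h1 : Tendsto (SF hH) atTop atTop := by
    apply tendsto_atTop_finset_of_monotone
    · intro m n hmn x hx
      rw [mem_SF] at *
      have : (m : ℝ) ≤ n := by exact_mod_cast hmn
      linarith
    · intro x
      obtain ⟨n, hn⟩ := exists_nat_ge ‖x.1‖
      exact ⟨n, by rw [mem_SF]; linarith⟩
  exact (eH_mult hH z).hasProd.comp h1

lemma eH_add [CompleteSpace K] [IsUltrametricDist K] {H : AddSubgroup K}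
    (hH : StronglyDiscrete H) (z w : K) : eH H (z + w) = eH H z + eH H w := by
  classical
  refine tendsto_nhds_unique (eH_lim hH (z + w)) ?_
  have := (eH_lim hH z).add (eH_lim hH w)
  refine this.congr (fun n => ?_)
  rw [EF_add _ (zero_mem_TF hH n) (sub_mem_TF hH n)]

lemma eH_zero {H : AddSubgroup K} : eH H 0 = 0 := by simp [eH]

lemma eH_ker [CompleteSpace K] [IsUltrametricDist K] {H : AddSubgroup K}
    (hH : StronglyDiscrete H) (z : K) : eH H z = 0 ↔ z ∈ H := by
  classical
  constructor
  · intro h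
    obtain ⟨n, hn⟩ := exists_nat_ge (2 * ‖z‖)
    have := eH_approx hH z n (1/2) (by norm_num) (by norm_num) (by linarith)
    rw [h, zero_sub, norm_neg] at this
    have h0 : EF (TF hH n) z = 0 := by
      rw [← norm_le_zero_iff]; linarith
    have h1 := EF_eq _ (zero_mem_TF hH n) z
    rw [h0, zero_mul] at h1
    obtain ⟨x, hx, hzx⟩ := Finset.prod_eq_zero_iff.1 h1.symm
    rw [sub_eq_zero.1 hzx]
    exact ((mem_TF hH n x).1 hx).1
  · intro h
    by_cases hz : z = 0
    · rw [hz, eH_zero]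
    · rw [eH, tprod_of_exists_eq_zero ⟨⟨z, h, hz⟩, by simp [hz]⟩, mul_zero]

open Filter Topology in
lemma eH_cont [CompleteSpace K] [IsUltrametricDist K] {H : AddSubgroup K}
    (hH : StronglyDiscrete H) : Continuous (eH H) := by
  classical
  have : Continuous (AddMonoidHom.mk' (eH H) (eH_add hH)) := by
    apply continuous_of_continuousAt_zero
    rw [ContinuousAt]
    simp only [AddMonoidHom.mk'_apply, eH_zero]
    have hc : Continuous (EF (TF hH 0)) := by
      unfold EF
      fun_prop
    have h0 : Tendsto (fun z => ‖EF (TF hH 0) z‖) (𝓝 0) (𝓝 0) := by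
      have := (hc.norm.tendsto 0)
      simpa [EF] using this
    apply squeeze_zero_norm' _ h0
    filter_upwards [Metric.ball_mem_nhds (0 : K) one_pos] with z hz
    rw [mem_ball_zero_iff] at hz
    have := eH_approx hH z 0 1 (by norm_num) (by norm_num) (by simpa using hz.le)
    calc ‖eH H z‖ = ‖(eH H z - EF (TF hH 0) z) + EF (TF hH 0) z‖ := by rw [sub_add_cancel]
      _ ≤ max _ _ := IsUltrametricDist.norm_add_le_max _ _
      _ ≤ _ := max_le (by simpa using this) le_rfl
  exact this

lemma eH_step [CompleteSpace K] [IsAlgClosed K] [IsUltrametricDist K] {H : AddSubgroup K}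
    (hH : StronglyDiscrete H) (c : K) :
    ∃ w, ‖w‖ ≤ ‖c‖ ∧ ‖c - eH H w‖ ≤ ‖c‖ * (1/2) := by
  classical
  obtain ⟨n, hn⟩ := exists_nat_ge (2 * ‖c‖)
  obtain ⟨w, hw, hwc⟩ := EF_surj (TF hH n) (zero_mem_TF hH n) (sub_mem_TF hH n) c
  refine ⟨w, hwc, ?_⟩
  have := eH_approx hH w n (1/2) (by norm_num) (by norm_num) (by linarith)
  rwa [hw, norm_sub_rev] at this

open Filter Topology in
lemma eH_surj [CompleteSpace K] [IsAlgClosed K] [IsUltrametricDist K] {H : AddSubgroup K}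
    (hH : StronglyDiscrete H) : Function.Surjective (eH H) := by
  intro c
  choose g hg1 hg2 using eH_step hH
  let d : ℕ → K := fun n => (fun x => x - eH H (g x))^[n] c
  have hd0 : d 0 = c := rfl
  have hd : ∀ n, d (n+1) = d n - eH H (g (d n)) := fun n =>
    Function.iterate_succ_apply' _ _ _
  have hdn : ∀ n, ‖d n‖ ≤ ‖c‖ * (1/2)^n := by
    intro n
    induction n with
    | zero => simp [hd0]
    | succ n ih =>
      rw [hd, pow_succ]
      refine (hg2 _).trans ?_
      linarith
  have hgs : Summable (fun n => ‖c‖ * (1/2 : ℝ)^n) := summable_geometric_two.mul_left _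
  have hsum : Summable (fun n => g (d n)) :=
    Summable.of_norm_bounded hgs (fun n => (hg1 _).trans (hdn n))
  have hpart : ∀ n, eH H (∑ i ∈ Finset.range n, g (d i)) = c - d n := by
    intro n
    induction n with
    | zero => simp [eH_zero, hd0]
    | succ n ih => rw [Finset.sum_range_succ, eH_add hH, ih, hd]; ring
  refine ⟨∑' n, g (d n), ?_⟩
  have h1 := ((eH_cont hH).tendsto _).comp hsum.hasSum.tendsto_sum_nat
  refine tendsto_nhds_unique h1 ?_
  have h2 : Tendsto d atTop (𝓝 0) := squeeze_zero_norm hdn hgs.tendsto_atTop_zero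
  have h3 : Tendsto (fun n => c - d n) atTop (𝓝 (c - 0)) := h2.const_sub c
  rw [sub_zero] at h3
  exact h3.congr (fun n => (hpart n).symm)

lemma eH_lin {H : AddSubgroup K} (q : ℕ)
    (hq : ∀ x : K, x ^ q = x → ∀ h ∈ H, x * h ∈ H) (α : K) (hα : α ^ q = α) (z : K) :
    eH H (α * z) = α * eH H z := by
  by_cases h0 : α = 0
  · simp [h0, eH_zero]
  have hinv : α⁻¹ ^ q = α⁻¹ := by rw [inv_pow, hα]
  let e : {x : K // x ∈ H ∧ x ≠ 0} ≃ {x : K // x ∈ H ∧ x ≠ 0} :=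
    { toFun := fun x => ⟨α * x.1, hq α hα _ x.2.1, mul_ne_zero h0 x.2.2⟩
      invFun := fun x => ⟨α⁻¹ * x.1, hq _ hinv _ x.2.1, mul_ne_zero (inv_ne_zero h0) x.2.2⟩
      left_inv := fun x => by ext; simp [h0]
      right_inv := fun x => by ext; simp [h0] }
  rw [eH, eH, ← e.tprod_eq, mul_assoc]
  congr 2
  apply tprod_congr
  intro x
  have : (e x).1 = α * x.1 := rfl
  rw [this, mul_div_mul_left _ _ h0]

end

/-- Let `K` be an algebraically closed field of characteristic `p`, complete
with respect to a nontrivial nonarchimedean absolute value, and let `H ⊂ K` be a strongly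
discrete subgroup.  Then the product defining `e_H(z)` converges for every `z ∈ K`; the
function `e_H : K → K` is a surjective homomorphism of additive groups whose kernel is
exactly `H` (hence it induces an isomorphism `K/H ≅ K`); and if `q = p^m` is a power of `p`
and `H` is an `𝔽_q`-subspace of `K` (where `𝔽_q = {x : K | x ^ q = x}`), then `e_H` is
`𝔽_q`-linear. -/
theorem statement0 (p : ℕ) (hp : p.Prime)
    {K : Type*} [NormedField K] [CompleteSpace K] [IsAlgClosed K] [IsUltrametricDist K]
    [CharP K p] (hnontriv : ∃ x : K, x ≠ 0 ∧ ‖x‖ ≠ 1)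
    (H : AddSubgroup K) (hH : StronglyDiscrete H) :
    (∀ z : K, Multipliable fun h : {x : K // x ∈ H ∧ x ≠ 0} => (1 - z / h.1)) ∧
    (∀ z w : K, eH H (z + w) = eH H z + eH H w) ∧
    Function.Surjective (eH H) ∧
    (∀ z : K, eH H z = 0 ↔ z ∈ H) ∧
    (∀ m : ℕ, 0 < m →
      (∀ x : K, x ^ p ^ m = x → ∀ h ∈ H, x * h ∈ H) →
      ∀ α : K, α ^ p ^ m = α → ∀ z : K, eH H (α * z) = α * eH H z) := by
  refine ⟨fun z => ?_, eH_add hH, eH_surj hH, eH_ker hH, fun m _ hq α hα z =>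
    eH_lin _ hq α hα z⟩
  simpa only [sub_eq_add_neg] using eH_mult hH z


end Paper
end
end

section
/- Let A be a Dedekind domain with fraction field F and let r ≥ 2 be an integer. The map sending a nonzero vector x = (x₁,…,x_r) ∈ F^r to the class in Cl(A) of the fractional ideal I(x) := A·x₁ + ⋯ + A·x_r induces a well-defined bijection from the orbit space GL_r(A)\ℙ^{r−1}(F) onto Cl(A); equivalently, the double coset space GL_r(A)\GL_r(F)/P(F) is in bijection with Cl(A). In particular, the double cosets can all be represented by elements of GL_r(A) if and only if Cl(A) is trivial. -/
noncomputable section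

namespace Paper

/-- The subgroup `GL_r(R) < GL_r(F)` of invertible matrices all of whose entries, as well
as the entries of the inverse, lie in a subring `R ⊆ F`. -/
def entriesIn {F : Type*} [Field F] {r : ℕ} (R : Subring F) :
    Subgroup (Matrix (Fin r) (Fin r) F)ˣ where
  carrier := {g | (∀ i j, (g : Matrix (Fin r) (Fin r) F) i j ∈ R) ∧
    (∀ i j, ((g⁻¹ : (Matrix (Fin r) (Fin r) F)ˣ) : Matrix (Fin r) (Fin r) F) i j ∈ R)}
  one_mem' := by
    refine ⟨?_, ?_⟩ <;>
      · intro i j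
        simp only [inv_one, Units.val_one, Matrix.one_apply]
        split_ifs <;> simp [R.one_mem, R.zero_mem]
  mul_mem' := by
    rintro a b ⟨ha1, ha2⟩ ⟨hb1, hb2⟩
    refine ⟨?_, ?_⟩
    · intro i j
      rw [Units.val_mul, Matrix.mul_apply]
      exact sum_mem fun k _ => R.mul_mem (ha1 i k) (hb1 k j)
    · intro i j
      rw [mul_inv_rev, Units.val_mul, Matrix.mul_apply]
      exact sum_mem fun k _ => R.mul_mem (hb2 i k) (ha2 k j)
  inv_mem' := by
    rintro a ⟨ha1, ha2⟩
    refine ⟨ha2, ?_⟩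
    simpa only [inv_inv] using ha1

/-- The parabolic subgroup `P(F) < GL_r(F)` of matrices whose first column vanishes below
the `(1,1)` entry (equivalently, the stabiliser of the line spanned by the first standard
basis vector). -/
def parabolic (F : Type*) [Field F] (r : ℕ) [NeZero r] :
    Subgroup (Matrix (Fin r) (Fin r) F)ˣ where
  carrier := {g | (∀ i : Fin r, i ≠ 0 → (g : Matrix (Fin r) (Fin r) F) i 0 = 0) ∧
    (∀ i : Fin r, i ≠ 0 → ((g⁻¹ : (Matrix (Fin r) (Fin r) F)ˣ) : Matrix (Fin r) (Fin r) F) i 0 = 0)}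
  one_mem' := by
    refine ⟨?_, ?_⟩ <;>
      · intro i hi
        simp only [inv_one, Units.val_one]
        exact Matrix.one_apply_ne hi
  mul_mem' := by
    rintro a b ⟨ha1, ha2⟩ ⟨hb1, hb2⟩
    refine ⟨?_, ?_⟩
    · intro i hi
      rw [Units.val_mul, Matrix.mul_apply]
      refine Finset.sum_eq_zero fun l _ => ?_
      by_cases hl : l = 0
      · subst hl; rw [ha1 i hi, zero_mul]
      · rw [hb1 l hl, mul_zero]
    · intro i hi
      rw [mul_inv_rev, Units.val_mul, Matrix.mul_apply]
      refine Finset.sum_eq_zero fun l _ => ?_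
      by_cases hl : l = 0
      · subst hl; rw [hb2 i hi, zero_mul]
      · rw [ha2 l hl, mul_zero]
  inv_mem' := by
    rintro a ⟨ha1, ha2⟩
    refine ⟨ha2, ?_⟩
    simpa only [inv_inv] using ha1

set_option linter.overlappingInstances false
set_option linter.unusedSectionVars false
section helpers
variable {A : Type*} [CommRing A] [IsDomain A] [IsDedekindDomain A]

theorem aux_stable (L : Ideal A) (hL : L ≠ ⊥) (a b : A) :
    ∃ t : A, L ⊔ Ideal.span {b + t * a} = L ⊔ Ideal.span {b} ⊔ Ideal.span {a} := by
  classical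
  set I : Ideal A := L ⊔ Ideal.span {b} ⊔ Ideal.span {a} with hI
  have hLI : L ≤ I := le_sup_left.trans le_sup_left
  have hbI : b ∈ I := (le_sup_right.trans le_sup_left : Ideal.span {b} ≤ I)
    (Ideal.mem_span_singleton_self b)
  have haI : a ∈ I := (le_sup_right : Ideal.span {a} ≤ I) (Ideal.mem_span_singleton_self a)
  have hI0 : I ≠ ⊥ := fun h => hL (le_bot_iff.1 (h ▸ hLI))
  obtain ⟨Q, hQ⟩ := Ideal.dvd_iff_le.mpr hLI
  have hQ0 : Q ≠ 0 := by
    rintro rfl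
    apply hL; simpa using hQ
  have hfin := Ideal.finite_factors hQ0
  obtain ⟨t, ht⟩ := IsDedekindDomain.exists_forall_sub_mem_ideal (s := hfin.toFinset)
    (fun v => v.asIdeal) (fun _ => 1) (fun v _ => v.prime)
    (fun v _ w _ hvw h => hvw (IsDedekindDomain.HeightOneSpectrum.ext h))
    (fun v => if b ∈ I * v.1.asIdeal then 1 else 0)
  refine ⟨t, ?_⟩
  have hJI : L ⊔ Ideal.span {b + t * a} ≤ I := by
    refine sup_le hLI ?_
    rw [Ideal.span_singleton_le_iff_mem]
    exact I.add_mem hbI (I.mul_mem_left _ haI)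
  obtain ⟨K, hK⟩ := Ideal.dvd_iff_le.mpr hJI
  by_cases hKt : K = ⊤
  · rw [hK, hKt, Ideal.mul_top]
  exfalso
  obtain ⟨P, hP, hKP⟩ := Ideal.exists_le_maximal K hKt
  have hJP : L ⊔ Ideal.span {b + t * a} ≤ I * P := hK ▸ Ideal.mul_mono_right hKP
  have hLP : L ≤ I * P := le_sup_left.trans hJP
  have hbt : b + t * a ∈ I * P := hJP ((le_sup_right : Ideal.span {b + t * a} ≤ _)
    (Ideal.mem_span_singleton_self _))
  have hPQ : P ∣ Q := by
    have : I * P ∣ I * Q := by rw [← hQ]; exact Ideal.dvd_iff_le.mpr hLP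
    exact (mul_dvd_mul_iff_left hI0).1 this
  have hP0 : P ≠ ⊥ := by
    rintro rfl
    exact hQ0 (zero_dvd_iff.1 hPQ)
  let v : IsDedekindDomain.HeightOneSpectrum A := ⟨P, hP.isPrime, hP0⟩
  have htv := ht v (by simpa [v] using hPQ)
  simp only [pow_one] at htv
  change t - (if b ∈ I * P then 1 else 0) ∈ P at htv
  by_cases hb : b ∈ I * P
  · rw [if_pos hb] at htv
    have hta : t * a ∈ I * P := by simpa using (I * P).sub_mem hbt hb
    have h1 : a * (t - 1) ∈ I * P := Ideal.mul_mem_mul haI htv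
    have ha : a ∈ I * P := by
      have := (I * P).sub_mem hta h1
      convert this using 1; ring
    have hle : I ≤ I * P := by
      refine sup_le (sup_le hLP ?_) ?_ <;> rw [Ideal.span_singleton_le_iff_mem] <;> assumption
    have : I * P ∣ I * 1 := by rw [mul_one]; exact Ideal.dvd_iff_le.mpr hle
    have := (mul_dvd_mul_iff_left hI0).1 this
    exact hP.ne_top (top_le_iff.1 (by simpa using Ideal.dvd_iff_le.1 this))
  · rw [if_neg hb, sub_zero] at htv
    apply hb
    have h1 : a * t ∈ I * P := Ideal.mul_mem_mul haI htv
    have := (I * P).sub_mem hbt h1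
    convert this using 1; ring

theorem aux_two (x y : Fin 2 → A)
    (h : Ideal.span (Set.range x) = Ideal.span (Set.range y)) :
    ∃ e : (Fin 2 → A) ≃ₗ[A] (Fin 2 → A), e x = y := by
  set I := Ideal.span (Set.range x) with hI
  by_cases h0 : I = ⊥
  · have hx : x = 0 := by
      funext i
      have : x i ∈ I := Ideal.subset_span ⟨i, rfl⟩
      simpa [h0] using this
    have hy : y = 0 := by
      funext i
      have : y i ∈ I := h ▸ Ideal.subset_span ⟨i, rfl⟩
      simpa [h0] using this
    exact ⟨LinearEquiv.refl _ _, by simp [hx, hy]⟩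
  obtain ⟨c, hcI, hc0⟩ := Submodule.exists_mem_ne_zero_of_ne_bot h0
  obtain ⟨I', hI'⟩ := Ideal.dvd_iff_le.mpr ((Ideal.span_singleton_le_iff_mem I).2 hcI)
  have key : ∀ z : Fin 2 → A, Ideal.span (Set.range z) = I →
      ∃ a ∈ I', ∃ b ∈ I', a * z 0 + b * z 1 = c := by
    intro z hz
    have hr : Set.range z = {z 0, z 1} := by
      ext w; simp [Fin.exists_fin_two, eq_comm]
    have hc : c ∈ I' * Ideal.span {z 0} ⊔ I' * Ideal.span {z 1} := by
      rw [← Ideal.mul_sup, ← Ideal.span_insert, ← hr, hz, mul_comm, ← hI']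
      exact Ideal.mem_span_singleton_self c
    obtain ⟨p, hp, q, hq, hpq⟩ := Submodule.mem_sup.1 hc
    obtain ⟨a, ha, rfl⟩ := Ideal.mem_mul_span_singleton.1 hp
    obtain ⟨b, hb, rfl⟩ := Ideal.mem_mul_span_singleton.1 hq
    exact ⟨a, ha, b, hb, hpq⟩
  obtain ⟨a, ha, b, hb, hab⟩ := key x rfl
  obtain ⟨a', ha', b', hb', hab'⟩ := key y h.symm
  have hxI : ∀ i, x i ∈ I := fun i => Ideal.subset_span ⟨i, rfl⟩
  have hyI : ∀ i, y i ∈ I := fun i => h ▸ Ideal.subset_span ⟨i, rfl⟩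
  have hd : ∀ p ∈ I, ∀ q ∈ I', ∃ s, p * q = c * s := by
    intro p hp q hq
    have : p * q ∈ Ideal.span {c} := hI' ▸ Ideal.mul_mem_mul hp hq
    exact Ideal.mem_span_singleton.1 this
  obtain ⟨s1, h1⟩ := hd _ (hyI 0) _ ha
  obtain ⟨s2, h2⟩ := hd _ (hxI 1) _ hb'
  obtain ⟨s3, h3⟩ := hd _ (hyI 0) _ hb
  obtain ⟨s4, h4⟩ := hd _ (hxI 0) _ hb'
  obtain ⟨s5, h5⟩ := hd _ (hyI 1) _ ha
  obtain ⟨s6, h6⟩ := hd _ (hxI 1) _ ha'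
  obtain ⟨s7, h7⟩ := hd _ (hyI 1) _ hb
  obtain ⟨s8, h8⟩ := hd _ (hxI 0) _ ha'
  let M : Matrix (Fin 2) (Fin 2) A := !![s1 + s2, s3 - s4; s5 - s6, s7 + s8]
  have hdet : M.det = 1 := by
    apply mul_left_cancel₀ (mul_ne_zero hc0 hc0)
    rw [Matrix.det_fin_two_of]
    have e : c * c * ((s1 + s2) * (s7 + s8) - (s3 - s4) * (s5 - s6)) =
      (c * s1 + c * s2) * (c * s7 + c * s8) - (c * s3 - c * s4) * (c * s5 - c * s6) := by ring
    rw [e, ← h1, ← h2, ← h3, ← h4, ← h5, ← h6, ← h7, ← h8]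
    have : c * c * 1 = (a * x 0 + b * x 1) * (a' * y 0 + b' * y 1) := by rw [hab, hab', mul_one]
    rw [this]; ring
  refine ⟨M.toLinearEquiv (Pi.basisFun A (Fin 2)) (by simp [hdet]), ?_⟩
  have hM : M.toLinearEquiv (Pi.basisFun A (Fin 2)) (by simp [hdet]) x = M.mulVec x := by
    change Matrix.toLin (Pi.basisFun A (Fin 2)) (Pi.basisFun A (Fin 2)) M x = _
    rw [Matrix.toLin_eq_toLin', Matrix.toLin'_apply]
  rw [hM]
  funext i
  apply mul_left_cancel₀ hc0
  fin_cases i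
  · simp [M, Matrix.mulVec, dotProduct, Fin.sum_univ_two, -mul_eq_mul_left_iff]
    linear_combination (-x 0) * h1 - x 0 * h2 - x 1 * h3 + x 1 * h4 + y 0 * hab
  · simp [M, Matrix.mulVec, dotProduct, Fin.sum_univ_two, -mul_eq_mul_left_iff]
    linear_combination (-x 0) * h5 + x 0 * h6 - x 1 * h7 - x 1 * h8 + y 1 * hab

theorem aux_zero (n : ℕ) (x : Fin (n + 3) → A) :
    ∃ (e : (Fin (n + 3) → A) ≃ₗ[A] (Fin (n + 3) → A)) (x' : Fin (n + 2) → A),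
      e x = Fin.cons 0 x' ∧ Ideal.span (Set.range x') = Ideal.span (Set.range x) := by
  by_cases hx : x = 0
  · subst hx
    refine ⟨LinearEquiv.refl _ _, 0, ?_, ?_⟩
    · funext i; refine Fin.cases ?_ (fun i => ?_) i <;> simp
    · simp
  obtain ⟨k, hk⟩ := Function.ne_iff.1 hx
  let e1 : (Fin (n + 3) → A) ≃ₗ[A] (Fin (n + 3) → A) :=
    LinearEquiv.funCongrLeft A A (Equiv.swap (Fin.last _) k)
  have hr1 : Set.range (e1 x) = Set.range x :=
    (Equiv.swap (Fin.last (n+2)) k).surjective.range_comp x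
  have hl1 : e1 x (Fin.last _) ≠ 0 := by
    simpa [e1, LinearEquiv.funCongrLeft_apply, LinearMap.funLeft_apply] using hk
  rw [← hr1]
  suffices ∀ x : Fin (n + 3) → A, x (Fin.last _) ≠ 0 → ∃ (e : (Fin (n + 3) → A) ≃ₗ[A] (Fin (n + 3) → A)) (x' : Fin (n + 2) → A),
      e x = Fin.cons 0 x' ∧ Ideal.span (Set.range x') = Ideal.span (Set.range x) by
    obtain ⟨e, x', h, h'⟩ := this _ hl1
    exact ⟨e1.trans e, x', h, h'⟩
  clear hk hl1 hr1 e1 k hx x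
  intro x hl
  let z : Fin (n + 1) → A := fun i => x i.succ.succ
  have hz : Ideal.span (Set.range z) ≠ ⊥ := by
    intro h
    have : z (Fin.last _) ∈ Ideal.span (Set.range z) := Ideal.subset_span ⟨_, rfl⟩
    rw [h] at this
    exact hl (by simpa [z] using this)
  obtain ⟨t, ht⟩ := aux_stable _ hz (x 0) (x 1)
  let x' : Fin (n + 2) → A := Fin.cons (x 1 + t * x 0) z
  have hx' : Ideal.span (Set.range x') = Ideal.span (Set.range x) := by
    have e2 : x = Fin.cons (x 0) (Fin.cons (x 1) z : Fin (n+2) → A) := by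
      funext i
      refine Fin.cases rfl (fun i => ?_) i
      refine Fin.cases rfl (fun i => ?_) i
      rfl
    rw [e2]
    simp only [x', Fin.range_cons, Ideal.span_insert]
    rw [sup_comm, ht]
    rw [sup_comm, sup_comm (Ideal.span {x 1})]
  let f2 : Module.Dual A (Fin (n + 3) → A) := t • LinearMap.proj 0
  let e2 := LinearEquiv.transvection (f := f2) (v := Pi.single 1 1) (by simp [f2])
  have h2 : e2 x = Fin.cons (x 0) x' := by
    change x + f2 x • (Pi.single 1 1 : Fin (n+3) → A) = _
    funext i
    refine Fin.cases (by simp) (fun i => ?_) i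
    refine Fin.cases (by simp [x', f2]) (fun i => ?_) i
    have : i.succ.succ ≠ 1 := by
      rw [← Fin.succ_zero_eq_one, Ne, Fin.succ_inj]; exact Fin.succ_ne_zero i
    simp [x', z, this]
  have h0 : x 0 ∈ Ideal.span (Set.range x') := hx' ▸ Ideal.subset_span ⟨0, rfl⟩
  obtain ⟨c, hc⟩ := (Submodule.mem_span_range_iff_exists_fun A).1 h0
  let f3 : Module.Dual A (Fin (n + 3) → A) := - ∑ i, c i • LinearMap.proj i.succ
  let e3 := LinearEquiv.transvection (f := f3) (v := Pi.single 0 1) (by simp [f3])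
  refine ⟨e2.trans e3, x', ?_, hx'⟩
  rw [LinearEquiv.trans_apply, h2]
  change _ + f3 _ • (Pi.single 0 1 : Fin (n+3) → A) = _
  funext i
  refine Fin.cases ?_ (fun i => by simp) i
  simp only [smul_eq_mul] at hc
  simp [f3, hc]

theorem aux_main (n : ℕ) : ∀ (x y : Fin (n + 2) → A),
    Ideal.span (Set.range x) = Ideal.span (Set.range y) →
    ∃ e : (Fin (n + 2) → A) ≃ₗ[A] (Fin (n + 2) → A), e x = y := by
  induction n with
  | zero => exact aux_two
  | succ n ih =>
    intro x y h
    obtain ⟨e, x', he, hx'⟩ := aux_zero n x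
    obtain ⟨f, y', hf, hy'⟩ := aux_zero n y
    obtain ⟨g, hg⟩ := ih x' y' (by rw [hx', hy', h])
    let G := (Fin.consLinearEquiv A (fun _ : Fin (n + 3) => A)).symm.trans
      (((LinearEquiv.refl A A).prodCongr g).trans (Fin.consLinearEquiv A (fun _ : Fin (n + 3) => A)))
    have hG : G (Fin.cons 0 x') = Fin.cons 0 y' := by
      simp [G, hg]
      rfl
    refine ⟨(e.trans G).trans f.symm, ?_⟩
    simp [he, hG, ← hf]

theorem aux_core {F : Type*} [Field F] [Algebra A F] [IsFractionRing A F]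
    (r : ℕ) (hr : 2 ≤ r) (x y : Fin r → F)
    (h : Submodule.span A (Set.range x) = Submodule.span A (Set.range y)) :
    ∃ γ δ : Matrix (Fin r) (Fin r) A, γ * δ = 1 ∧ δ * γ = 1 ∧
      ∀ i, y i = ∑ j, algebraMap A F (γ i j) * x j := by
  obtain ⟨n, rfl⟩ := Nat.exists_eq_add_of_le' hr
  obtain ⟨d, hd⟩ := IsLocalization.exist_integer_multiples_of_finite (nonZeroDivisors A)
    (Sum.elim x y)
  have hinj := IsFractionRing.injective A F
  have hd0 : algebraMap A F d ≠ 0 := by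
    simpa using nonZeroDivisors.coe_ne_zero d
  choose Z hZ using hd
  have hX : ∀ i, algebraMap A F (Z (Sum.inl i)) = algebraMap A F d * x i := fun i => by
    rw [hZ, Algebra.smul_def]; rfl
  have hY : ∀ i, algebraMap A F (Z (Sum.inr i)) = algebraMap A F d * y i := fun i => by
    rw [hZ, Algebra.smul_def]; rfl
  have gen : ∀ (p q : Fin (n+2) → F) (P Q : Fin (n+2) → A),
      (∀ i, algebraMap A F (P i) = algebraMap A F d * p i) →
      (∀ i, algebraMap A F (Q i) = algebraMap A F d * q i) →
      Submodule.span A (Set.range p) = Submodule.span A (Set.range q) →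
      Ideal.span (Set.range P) ≤ Ideal.span (Set.range Q) := by
    intro p q P Q hP hQ hpq
    rw [Ideal.span_le]
    rintro _ ⟨i, rfl⟩
    have : p i ∈ Submodule.span A (Set.range q) := hpq ▸ Submodule.subset_span ⟨i, rfl⟩
    obtain ⟨c, hc⟩ := (Submodule.mem_span_range_iff_exists_fun A).1 this
    refine (Submodule.mem_span_range_iff_exists_fun A).2 ⟨c, ?_⟩
    apply hinj
    rw [hP, ← hc, map_sum, Finset.mul_sum]
    refine Finset.sum_congr rfl fun j _ => ?_
    rw [smul_eq_mul, map_mul, hQ, Algebra.smul_def]; ring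
  obtain ⟨e, he⟩ := aux_main n (fun i => Z (Sum.inl i)) (fun i => Z (Sum.inr i))
    (le_antisymm (gen x y _ _ hX hY h) (gen y x _ _ hY hX h.symm))
  refine ⟨LinearMap.toMatrix' e.toLinearMap, LinearMap.toMatrix' e.symm.toLinearMap, ?_, ?_, ?_⟩
  · rw [← LinearMap.toMatrix'_comp]; simp
  · rw [← LinearMap.toMatrix'_comp]; simp
  · intro i
    apply mul_left_cancel₀ hd0
    rw [← hY]
    have h1 : (LinearMap.toMatrix' e.toLinearMap).mulVec (fun i => Z (Sum.inl i)) i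
        = Z (Sum.inr i) := by
      rw [LinearMap.toMatrix'_mulVec]
      exact congrFun he i
    rw [← h1, Matrix.mulVec, dotProduct, map_sum, Finset.mul_sum]
    refine Finset.sum_congr rfl fun j _ => ?_
    rw [map_mul, hX]; ring

theorem aux_span_le {F : Type*} [Field F] [Algebra A F]
    (r : ℕ) (x y : Fin r → F) (γ : Matrix (Fin r) (Fin r) A)
    (h : ∀ i, y i = ∑ j, algebraMap A F (γ i j) * x j) :
    Submodule.span A (Set.range y) ≤ Submodule.span A (Set.range x) := by
  rw [Submodule.span_le]
  rintro _ ⟨i, rfl⟩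
  refine (Submodule.mem_span_range_iff_exists_fun A).2 ⟨γ i, ?_⟩
  rw [h]
  exact Finset.sum_congr rfl fun j _ => by rw [Algebra.smul_def]

theorem aux_inv {F : Type*} [Field F] [Algebra A F]
    (r : ℕ) (x y : Fin r → F) (γ δ : Matrix (Fin r) (Fin r) A) (hδ : δ * γ = 1)
    (h : ∀ i, y i = ∑ j, algebraMap A F (γ i j) * x j) (i : Fin r) :
    x i = ∑ j, algebraMap A F (δ i j) * y j := by
  have hy : y = (γ.map (algebraMap A F)).mulVec x := by
    funext i; rw [h]; rfl
  have : (δ.map (algebraMap A F)).mulVec y = x := by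
    rw [hy, Matrix.mulVec_mulVec, ← Matrix.map_mul, hδ]
    simp
  exact (congrFun this i).symm

theorem aux_surj {F : Type*} [Field F] [Algebra A F] [IsFractionRing A F]
    (r : ℕ) (hr : 2 ≤ r) (J : FractionalIdeal (nonZeroDivisors A) F) (hJ : J ≠ 0) :
    ∃ x : Fin r → F, x ≠ 0 ∧ ∃ u : Fˣ,
        Submodule.span A (Set.range fun i => (u : F) * x i) = (J : Submodule A F) := by
  obtain ⟨n, rfl⟩ := Nat.exists_eq_add_of_le' hr
  obtain ⟨a, I, ha, hI⟩ := FractionalIdeal.exists_eq_spanSingleton_mul J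
  have ha' : algebraMap A F a ≠ 0 := by simpa using ha
  have hI0 : I ≠ ⊥ := by
    rintro rfl
    apply hJ; rw [hI]; simp
  obtain ⟨w, hw, hw0⟩ := Submodule.exists_mem_ne_zero_of_ne_bot hI0
  obtain ⟨b, hb⟩ := IsDedekindDomain.exists_sup_span_eq
    ((Ideal.span_singleton_le_iff_mem I).2 hw) (by simpa using hw0)
  have hw' : algebraMap A F w ≠ 0 := by simpa using hw0
  refine ⟨fun i => if i = 0 then algebraMap A F w else algebraMap A F b, ?_,
    Units.mk0 _ (inv_ne_zero ha'), ?_⟩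
  · intro h
    exact hw' (by simpa using congrFun h 0)
  · have hr : (Set.range fun i : Fin (n+2) => ((Units.mk0 _ (inv_ne_zero ha') : Fˣ) : F) *
        (if i = 0 then algebraMap A F w else algebraMap A F b)) =
        {(algebraMap A F a)⁻¹ * algebraMap A F w, (algebraMap A F a)⁻¹ * algebraMap A F b} := by
      ext z
      simp only [Set.mem_range, Units.val_mk0, Set.mem_insert_iff, Set.mem_singleton_iff]
      constructor
      · rintro ⟨i, rfl⟩
        by_cases hi : i = 0 <;> simp [hi]
      · rintro (rfl | rfl)
        · exact ⟨0, by simp⟩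
        · exact ⟨1, by simp⟩
    rw [hr, hI, ← hb, FractionalIdeal.coeIdeal_sup, ← FractionalIdeal.sup_eq_add]
    rw [Submodule.span_insert]
    simp [mul_add, FractionalIdeal.coeIdeal_span_singleton,
      FractionalIdeal.spanSingleton_mul_spanSingleton, FractionalIdeal.coe_add,
      FractionalIdeal.coe_spanSingleton]

end helpers

/-- (Proposition 6.4(a),(c).)  Let `A` be a Dedekind domain with fraction
field `F` and `r ≥ 2`.  Sending a nonzero `x ∈ F^r` to the class of the fractional ideal
`I(x) = A·x₁ + ⋯ + A·x_r` induces a well-defined bijection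
`GL_r(A)\ℙ^{r−1}(F) ≅ Cl(A)`:  two nonzero vectors have `I(x)`, `I(y)` in the same ideal
class iff they define the same point of `GL_r(A)\ℙ^{r−1}(F)` (well-definedness and
injectivity), and every ideal class arises (surjectivity).  In particular the double cosets
of `GL_r(A)\GL_r(F)/P(F)` can all be represented by elements of `GL_r(A)` iff `Cl(A)` is
trivial, i.e. iff every nonzero fractional ideal is principal. -/
theorem statement18 (A : Type*) [CommRing A] [IsDomain A] [IsDedekindDomain A]
    (F : Type*) [Field F] [Algebra A F] [IsFractionRing A F]
    (r : ℕ) (hr : 2 ≤ r) [NeZero r] :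
    (∀ x y : Fin r → F, x ≠ 0 → y ≠ 0 →
      ((∃ u : Fˣ, Submodule.span A (Set.range fun i => (u : F) * x i) =
          Submodule.span A (Set.range y)) ↔
        (∃ γ : Matrix (Fin r) (Fin r) A, IsUnit γ.det ∧ ∃ c : Fˣ,
          y = fun i => (c : F) * ∑ j, algebraMap A F (γ i j) * x j))) ∧
    (∀ J : FractionalIdeal (nonZeroDivisors A) F, J ≠ 0 →
      ∃ x : Fin r → F, x ≠ 0 ∧ ∃ u : Fˣ,
        Submodule.span A (Set.range fun i => (u : F) * x i) = (J : Submodule A F)) ∧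
    ((∀ g : (Matrix (Fin r) (Fin r) F)ˣ,
        ∃ γ ∈ entriesIn (R := (algebraMap A F).range) (r := r), ∃ ρ ∈ parabolic F r,
          g = γ * ρ) ↔
      (∀ J : FractionalIdeal (nonZeroDivisors A) F, J ≠ 0 →
        ∃ u : Fˣ, J = FractionalIdeal.spanSingleton (nonZeroDivisors A) (u : F))) := by
  refine ⟨?_, fun J hJ => aux_surj r hr J hJ, ?_, ?_⟩
  · intro x y hx hy
    constructor
    · rintro ⟨u, hu⟩
      obtain ⟨γ, δ, h1, h2, h⟩ := aux_core r hr _ _ hu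
      refine ⟨γ, (Matrix.isUnit_iff_isUnit_det γ).1 (IsUnit.of_mul_eq_one δ h1), u, ?_⟩
      funext i
      rw [h, Finset.mul_sum]
      exact Finset.sum_congr rfl fun j _ => by ring
    · rintro ⟨γ, hγ, c, h⟩
      have h' : ∀ i, y i = ∑ j, algebraMap A F (γ i j) * ((c : F) * x j) := by
        intro i
        refine (congrFun h i).trans ?_
        beta_reduce
        rw [Finset.mul_sum]
        exact Finset.sum_congr rfl fun j _ => by ring
      refine ⟨c, le_antisymm ?_ (aux_span_le r _ _ γ h')⟩
      exact aux_span_le r _ _ γ⁻¹ (aux_inv r _ _ γ γ⁻¹ (Matrix.nonsing_inv_mul γ hγ) h')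
  · intro H J hJ
    obtain ⟨x, hx, u, hxu⟩ := aux_surj r hr J hJ
    set z : Fin r → F := fun i => (u : F) * x i with hz
    have hz0 : ∃ k, z k ≠ 0 := by
      obtain ⟨k, hk⟩ := Function.ne_iff.1 hx
      exact ⟨k, mul_ne_zero u.ne_zero hk⟩
    obtain ⟨k, hk⟩ := hz0
    have top : ∀ (w : Fin r → F) (k : Fin r), w k ≠ 0 →
        Submodule.span F (Set.range w) = ⊤ := by
      intro w k hk
      exact Ideal.eq_top_of_isUnit_mem _ (Submodule.subset_span ⟨k, rfl⟩) (IsUnit.mk0 _ hk)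
    obtain ⟨G, D, hGD, hDG, hG⟩ := aux_core (A := F) (F := F) r hr (Pi.single 0 1) z
      ((top _ 0 (by simp)).trans (top z k hk).symm)
    have hG' : ∀ i, z i = G i 0 := by
      intro i; rw [hG]; simp [Pi.single_apply]
    obtain ⟨γ, ⟨hγ1, hγ2⟩, ρ, ⟨hρ, -⟩, hg⟩ := H ⟨G, D, hGD, hDG⟩
    have hg' : G = (γ : Matrix (Fin r) (Fin r) F) * (ρ : Matrix (Fin r) (Fin r) F) :=
      congrArg Units.val hg
    set p : F := (ρ : Matrix (Fin r) (Fin r) F) 0 0 with hp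
    have hzp : ∀ i, z i = (γ : Matrix (Fin r) (Fin r) F) i 0 * p := by
      intro i
      rw [hG', hg', Matrix.mul_apply, Finset.sum_eq_single 0]
      · intro l _ hl
        rw [hρ l hl, mul_zero]
      · simp
    have hp0 : p ≠ 0 := by
      intro h
      apply hk; rw [hzp, h, mul_zero]
    refine ⟨Units.mk0 p hp0, ?_⟩
    apply FractionalIdeal.coeToSubmodule_injective
    change (J : Submodule A F) = ((FractionalIdeal.spanSingleton (nonZeroDivisors A) p :
      FractionalIdeal (nonZeroDivisors A) F) : Submodule A F)
    rw [← hxu, FractionalIdeal.coe_spanSingleton]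
    apply le_antisymm
    · rw [Submodule.span_le]
      rintro _ ⟨i, rfl⟩
      obtain ⟨V, hV⟩ := hγ1 i 0
      refine Submodule.mem_span_singleton.2 ⟨V, ?_⟩
      rw [Algebra.smul_def, hV, ← hzp]
    · rw [Submodule.span_singleton_le_iff_mem]
      choose V hV using hγ2 0
      refine (Submodule.mem_span_range_iff_exists_fun A).2 ⟨V, ?_⟩
      have h1 : ∑ l, ((γ⁻¹ : (Matrix (Fin r) (Fin r) F)ˣ) : Matrix (Fin r) (Fin r) F) 0 l *
          (γ : Matrix (Fin r) (Fin r) F) l 0 = 1 := by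
        rw [← Matrix.mul_apply, Units.inv_mul, Matrix.one_apply_eq]
      calc ∑ i, V i • z i = ∑ l, (((γ⁻¹ : (Matrix (Fin r) (Fin r) F)ˣ) :
            Matrix (Fin r) (Fin r) F) 0 l * (γ : Matrix (Fin r) (Fin r) F) l 0) * p := by
            refine Finset.sum_congr rfl fun l _ => ?_
            rw [Algebra.smul_def, hV, hzp, mul_assoc]
        _ = p := by rw [← Finset.sum_mul, h1, one_mul]
  · intro H g
    let x : Fin r → F := fun i => (g : Matrix (Fin r) (Fin r) F) i 0
    have hinv : ∀ i, ∑ l, ((g⁻¹ : (Matrix (Fin r) (Fin r) F)ˣ) : Matrix (Fin r) (Fin r) F) i l *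
          x l = (1 : Matrix (Fin r) (Fin r) F) i 0 := by
      intro i
      rw [← Units.inv_mul g, Matrix.mul_apply]
    have hx0 : x ≠ 0 := by
      intro h
      have := hinv 0
      simp [h] at this
    let J : FractionalIdeal (nonZeroDivisors A) F := ⟨Submodule.span A (Set.range x),
      FractionalIdeal.isFractional_of_fg (Submodule.fg_span (Set.finite_range x))⟩
    have hJc : (J : Submodule A F) = Submodule.span A (Set.range x) := rfl
    have hJ : J ≠ 0 := by
      intro h
      apply hx0
      funext i
      have : x i ∈ (J : Submodule A F) := Submodule.subset_span ⟨i, rfl⟩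
      rw [h] at this
      simpa using this
    obtain ⟨u, hu⟩ := H J hJ
    have hsp : Submodule.span A (Set.range (Pi.single 0 (u : F) : Fin r → F)) =
        Submodule.span A (Set.range x) := by
      rw [← hJc, hu, FractionalIdeal.coe_spanSingleton]
      apply le_antisymm
      · rw [Submodule.span_le]
        rintro _ ⟨i, rfl⟩
        by_cases hi : i = 0
        · subst hi
          simpa using Submodule.mem_span_singleton_self (R := A) (u : F)
        · simp [hi]
      · rw [Submodule.span_singleton_le_iff_mem]
        exact Submodule.subset_span ⟨0, by simp⟩
    obtain ⟨γ, δ, h1, h2, h⟩ := aux_core r hr _ _ hsp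
    have h' : ∀ i, x i = algebraMap A F (γ i 0) * u := by
      intro i; rw [h]; simp [Pi.single_apply]
    let Γ : (Matrix (Fin r) (Fin r) F)ˣ := ⟨γ.map (algebraMap A F), δ.map (algebraMap A F),
      by rw [← Matrix.map_mul, h1]; simp, by rw [← Matrix.map_mul, h2]; simp⟩
    refine ⟨Γ, ⟨fun i j => ⟨γ i j, rfl⟩, fun i j => ⟨δ i j, rfl⟩⟩, Γ⁻¹ * g, ⟨?_, ?_⟩, by simp⟩
    · intro i hi
      have e : ∑ l, ((Γ⁻¹ : (Matrix (Fin r) (Fin r) F)ˣ) : Matrix (Fin r) (Fin r) F) i l *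
          (Γ : Matrix (Fin r) (Fin r) F) l 0 = 0 := by
        rw [← Matrix.mul_apply, Units.inv_mul, Matrix.one_apply_ne hi]
      rw [Units.val_mul, Matrix.mul_apply]
      calc _ = ∑ l, (((Γ⁻¹ : (Matrix (Fin r) (Fin r) F)ˣ) : Matrix (Fin r) (Fin r) F) i l *
          (Γ : Matrix (Fin r) (Fin r) F) l 0) * u := by
            refine Finset.sum_congr rfl fun l _ => ?_
            rw [mul_assoc]
            exact congrArg _ (h' l)
        _ = 0 := by rw [← Finset.sum_mul, e, zero_mul]
    · intro i hi
      have e := hinv i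
      rw [Matrix.one_apply_ne hi] at e
      rw [mul_inv_rev, inv_inv, Units.val_mul, Matrix.mul_apply]
      apply mul_right_cancel₀ u.ne_zero
      rw [zero_mul, Finset.sum_mul, ← e]
      refine Finset.sum_congr rfl fun l _ => ?_
      rw [mul_assoc, h' l]
      rfl

end Paper
end
end
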